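/- arXiv:2002.03783 — 2 statements merged into one kernel-verified Lean document; each statement's English description precedes it below -/
import Mathlib

section
/- All solutions (n, r, x) in nonnegative integers n, r with x a positive integer of the Diophantine equation F_{n+3}^x − F_n^x = L_r are (n,r,x) = (0,3,2), (0,0,1), (1,0,1), and (2,3,1). -/
/-- The Lucas sequence: `L 0 = 2`, `L 1 = 1`, `L (n+2) = L (n+1) + L n`. -/
def lucas : ℕ → ℕ
  | 0 => 2
  | 1 => 1
  | n + 2 => lucas (n + 1) + lucas n

theorem lucas_cast_eq_fib (n : ℕ) :
    (lucas n : ℤ) = 2 * Nat.fib (n + 1) - Nat.fib n := by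
  induction n using lucas.induct with
  | case1 => simp [lucas]
  | case2 => simp [lucas]
  | case3 n ih₁ ih₂ =>
    have h₁ := Nat.fib_add_two (n := n)
    have h₂ := Nat.fib_add_two (n := n + 1)
    simp only [lucas, Nat.succ_eq_add_one] at *
    push_cast
    lia

theorem fib_cassini (n : ℕ) :
    (Nat.fib (n + 1) : ℤ) ^ 2 - Nat.fib (n + 1) * Nat.fib n - (Nat.fib n : ℤ) ^ 2 = (-1) ^ n := by
  induction n with
  | zero => simp
  | succ n ih =>
    rw [Nat.fib_add_two, pow_succ (-1 : ℤ), ← ih]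
    push_cast
    ring

theorem fib_two_mul_cast (n : ℕ) :
    (Nat.fib (2 * n) : ℤ) = Nat.fib n * (2 * Nat.fib (n + 1) - Nat.fib n) := by
  have h := Nat.fib_add_two (n := 2 * n)
  have h₁ := Nat.fib_two_mul_add_one n
  have h₂ := Nat.fib_two_mul_add_two n
  zify at h h₁ h₂
  linear_combination h₂ - h - h₁

theorem fib_two_mul_eq_fib_mul_lucas (n : ℕ) : Nat.fib (2 * n) = Nat.fib n * lucas n := by
  zify
  rw [lucas_cast_eq_fib, fib_two_mul_cast]

theorem lucas_two_mul (n : ℕ) : (lucas (2 * n) : ℤ) = (lucas n : ℤ) ^ 2 - 2 * (-1) ^ n := by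
  have h₁ := Nat.fib_two_mul_add_one n
  zify at h₁
  rw [lucas_cast_eq_fib, lucas_cast_eq_fib, ← fib_cassini, fib_two_mul_cast, h₁]
  ring

theorem lucas_two_mul_add_one (n : ℕ) :
    (lucas (2 * n + 1) : ℤ) = 5 * (Nat.fib n * Nat.fib (n + 1)) + (-1) ^ n := by
  have h₁ := Nat.fib_two_mul_add_one n
  have h₂ := Nat.fib_two_mul_add_two n
  zify at h₁ h₂
  rw [lucas_cast_eq_fib, ← fib_cassini, h₂, h₁]
  ring

theorem lucas_mod_eight (n : ℕ) : lucas n % 8 = lucas (n % 12) % 8 := by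
  induction n using Nat.strong_induction_on with
  | _ n ih =>
    rcases lt_or_ge n 12 with h | h
    · rw [Nat.mod_eq_of_lt h]
    · obtain ⟨k, rfl⟩ := Nat.exists_eq_add_of_le' h
      rw [Nat.add_mod_right, ← ih k (by lia)]
      simp only [lucas]
      lia

theorem lucas_mod_five (n : ℕ) : lucas n % 5 = lucas (n % 4) % 5 := by
  induction n using Nat.strong_induction_on with
  | _ n ih =>
    rcases lt_or_ge n 4 with h | h
    · rw [Nat.mod_eq_of_lt h]
    · obtain ⟨k, rfl⟩ := Nat.exists_eq_add_of_le' h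
      rw [Nat.add_mod_right, ← ih k (by lia)]
      have h₁ := lucas_cast_eq_fib k
      have h₂ := lucas_cast_eq_fib (k + 1)
      have h₃ := Nat.fib_add_two (n := k)
      simp only [lucas]
      lia

theorem not_eight_dvd_lucas (n : ℕ) : ¬ 8 ∣ lucas n := by
  have h := lucas_mod_eight n
  have hn : n % 12 < 12 := Nat.mod_lt _ (by norm_num)
  interval_cases n % 12 <;> simp only [lucas] at h <;> lia

theorem not_five_dvd_lucas (n : ℕ) : ¬ 5 ∣ lucas n := by
  have h := lucas_mod_five n
  have hn : n % 4 < 4 := Nat.mod_lt _ (by norm_num)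
  interval_cases n % 4 <;> simp only [lucas] at h <;> lia

theorem le_lucas (n : ℕ) : n ≤ lucas n ∧ 1 ≤ lucas n := by
  induction n using lucas.induct with
  | case1 => simp [lucas]
  | case2 => simp [lucas]
  | case3 n ih₁ ih₂ =>
    simp only [lucas, Nat.succ_eq_add_one] at *
    lia

theorem lucas_eq_two_iff {n : ℕ} : lucas n = 2 ↔ n = 0 := by
  refine ⟨fun h => ?_, fun h => h ▸ rfl⟩
  have hn : n ≤ 2 := h ▸ (le_lucas n).1
  interval_cases n <;> simp_all [lucas]

theorem lucas_eq_four_iff {n : ℕ} : lucas n = 4 ↔ n = 3 := by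
  refine ⟨fun h => ?_, fun h => h ▸ rfl⟩
  have hn : n ≤ 4 := h ▸ (le_lucas n).1
  interval_cases n <;> simp_all [lucas]

theorem gcd_fib_lucas_dvd_two (n : ℕ) : Nat.gcd (Nat.fib n) (lucas n) ∣ 2 := by
  have hsum : lucas n + Nat.fib n = 2 * Nat.fib (n + 1) := by
    zify
    rw [lucas_cast_eq_fib]
    ring
  have hdvd : Nat.gcd (Nat.fib n) (lucas n) ∣ 2 * Nat.fib (n + 1) :=
    hsum ▸ dvd_add (Nat.gcd_dvd_right _ _) (Nat.gcd_dvd_left _ _)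
  exact ((Nat.fib_coprime_fib_succ n).coprime_dvd_left (Nat.gcd_dvd_left _ _)).dvd_of_dvd_mul_right
    hdvd

theorem le_three_of_fib_dvd_two {n : ℕ} (h : Nat.fib n ∣ 2) : n ≤ 3 := by
  by_contra! hn
  have h₁ : Nat.fib 4 ≤ Nat.fib n := Nat.fib_mono hn
  have h₂ := Nat.le_of_dvd (by norm_num) h
  have h₃ : Nat.fib 4 = 3 := rfl
  lia

theorem dvd_of_fib_dvd_fib {m n : ℕ} (hm : 3 ≤ m) (h : Nat.fib m ∣ Nat.fib n) : m ∣ n := by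
  have hgcd : Nat.fib (m.gcd n) = Nat.fib m := by
    rw [Nat.fib_gcd, Nat.gcd_eq_left h]
  have hle : m ≤ m.gcd n := by
    by_contra! hlt
    obtain ⟨k, rfl⟩ := Nat.exists_eq_add_of_le' (show 1 ≤ m by lia)
    have h₁ : Nat.fib ((k + 1).gcd n) ≤ Nat.fib k := Nat.fib_mono (by lia)
    have h₂ := Nat.fib_lt_fib_succ (n := k) (by lia)
    lia
  have heq : m.gcd n = m := le_antisymm (Nat.gcd_le_left _ (by lia)) hle
  exact Nat.gcd_eq_left_iff_dvd.mp heq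

theorem le_four_of_fib_dvd_lucas {m r : ℕ} (h : Nat.fib m ∣ lucas r) : m ≤ 4 := by
  rcases lt_or_ge m 3 with hm | hm
  · lia
  have key : ∀ d, Nat.fib d ∣ lucas r → d ∣ r → d ≤ 3 := fun d hd hdr =>
    le_three_of_fib_dvd_two
      ((Nat.dvd_gcd (Nat.fib_dvd _ _ hdr) hd).trans (gcd_fib_lucas_dvd_two r))
  have hdvd : m ∣ 2 * r :=
    dvd_of_fib_dvd_fib hm (fib_two_mul_eq_fib_mul_lucas r ▸ h.mul_left _)
  rcases Nat.even_or_odd' m with ⟨d, rfl | rfl⟩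
  · have hd := key d ((Nat.fib_dvd _ _ (Nat.dvd_mul_left d 2)).trans h)
      (Nat.dvd_of_mul_dvd_mul_left (by norm_num) hdvd)
    have hd₃ : d ≠ 3 := by
      rintro rfl
      exact not_eight_dvd_lucas r h
    lia
  · have hcop : Nat.Coprime (2 * d + 1) 2 := by simp
    have := key _ h (hcop.dvd_of_dvd_mul_left hdvd)
    lia

theorem two_pow_eq_lucas {r x : ℕ} (hx : 0 < x) (h : 2 ^ x = lucas r) :
    r = 0 ∧ x = 1 ∨ r = 3 ∧ x = 2 := by
  have hx₃ : x < 3 := by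
    by_contra! hx₃
    exact not_eight_dvd_lucas r (h ▸ pow_dvd_pow 2 hx₃)
  interval_cases x
  · exact Or.inl ⟨lucas_eq_two_iff.mp h.symm, rfl⟩
  · exact Or.inr ⟨lucas_eq_four_iff.mp h.symm, rfl⟩

theorem three_pow_mod_eight (x : ℕ) : 3 ^ x % 8 = 1 ∨ 3 ^ x % 8 = 3 := by
  induction x with
  | zero => simp
  | succ x ih => lia

theorem eq_two_of_sq_eq_three_pow_add_one {l x : ℕ} (h : l ^ 2 = 3 ^ x + 1) : l = 2 := by
  have hl : 1 ≤ l := by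
    by_contra! hl
    simp [Nat.lt_one_iff.mp hl] at h
  obtain ⟨k, rfl⟩ := Nat.exists_eq_add_of_le' hl
  have hk : k * (k + 2) = 3 ^ x := by linarith [h, show (k + 1) ^ 2 = k * (k + 2) + 1 by ring]
  obtain ⟨a, -, ha⟩ := (Nat.dvd_prime_pow Nat.prime_three).mp (hk ▸ Nat.dvd_mul_right k (k + 2))
  obtain ⟨b, -, hb⟩ := (Nat.dvd_prime_pow Nat.prime_three).mp (hk ▸ Nat.dvd_mul_left (k + 2) k)
  rcases a with _ | a
  · lia
  · rcases b with _ | b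
    · lia
    · rw [pow_succ] at ha hb
      lia

theorem sq_add_three_ne_three_pow {l x : ℕ} (hl : 0 < l) : l ^ 2 + 3 ≠ 3 ^ x := by
  intro h
  have hl₂ : 0 < l ^ 2 := by positivity
  rcases x with _ | _ | x
  · lia
  · lia
  · have hmod : (l ^ 2 + 3) % 9 = 0 := by
      rw [h, pow_add]
      lia
    have hlt : l % 9 < 9 := Nat.mod_lt _ (by norm_num)
    rw [Nat.add_mod, Nat.pow_mod] at hmod
    interval_cases l % 9 <;> simp at hmod

theorem three_pow_eq_lucas_add_one {r x : ℕ} (h : 3 ^ x = lucas r + 1) :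
    r = 0 ∧ x = 1 := by
  have hr : r % 12 = 0 ∨ r % 12 = 6 := by
    have h₈ := lucas_mod_eight r
    have h₃ := three_pow_mod_eight x
    have hlt : r % 12 < 12 := Nat.mod_lt _ (by norm_num)
    interval_cases r % 12 <;> simp only [lucas] at h₈ <;> lia
  obtain ⟨j, rfl⟩ : ∃ j, r = 2 * j := ⟨r / 2, by lia⟩
  have hdouble := lucas_two_mul j
  rcases hr with hr | hr
  · have hj : Even j := Nat.even_iff.mpr (by lia)
    rw [hj.neg_one_pow] at hdouble
    have hsq : lucas j ^ 2 = 3 ^ x + 1 := by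
      zify at h ⊢
      lia
    have hl := eq_two_of_sq_eq_three_pow_add_one hsq
    have hx₁ : 3 ^ x = 3 ^ 1 := by
      rw [hl] at hsq
      lia
    exact ⟨by rw [lucas_eq_two_iff.mp hl], Nat.pow_right_injective (by norm_num) hx₁⟩
  · have hj : Odd j := Nat.odd_iff.mpr (by lia)
    rw [hj.neg_one_pow] at hdouble
    refine absurd ?_ (sq_add_three_ne_three_pow (l := lucas j) (x := x) (le_lucas j).2)
    zify at h ⊢
    lia

theorem five_pow_eq_lucas_add_one {r x : ℕ} (hx : 0 < x) (h : 5 ^ x = lucas r + 1) :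
    r = 3 ∧ x = 1 := by
  obtain ⟨y, rfl⟩ := Nat.exists_eq_add_of_le' hx
  have hr : r % 4 = 3 := by
    have h₅ := lucas_mod_five r
    have hlt : r % 4 < 4 := Nat.mod_lt _ (by norm_num)
    rw [pow_succ] at h
    interval_cases r % 4 <;> simp only [lucas] at h₅ <;> lia
  obtain ⟨m, rfl⟩ : ∃ m, r = 2 * (2 * m + 1) + 1 := ⟨r / 4, by lia⟩
  have hodd : Odd (2 * m + 1) := ⟨m, rfl⟩
  have hprod : Nat.fib (2 * m + 1) * Nat.fib (2 * m + 2) = 5 ^ y := by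
    have hl := lucas_two_mul_add_one (2 * m + 1)
    rw [hodd.neg_one_pow] at hl
    zify at h ⊢
    rw [pow_succ] at h
    linarith
  obtain ⟨a, -, ha⟩ := (Nat.dvd_prime_pow Nat.prime_five).mp (hprod ▸ Nat.dvd_mul_right _ _)
  obtain ⟨b, -, hb⟩ := (Nat.dvd_prime_pow Nat.prime_five).mp (hprod ▸ Nat.dvd_mul_left _ _)
  have hcop := Nat.fib_coprime_fib_succ (2 * m + 1)
  have hm : m = 0 := by
    by_contra hm
    have h₃ : Nat.fib 3 ≤ Nat.fib (2 * m + 1) := Nat.fib_mono (by lia)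
    have h₄ : Nat.fib 3 ≤ Nat.fib (2 * m + 2) := Nat.fib_mono (by lia)
    rw [ha, show Nat.fib 3 = 2 from rfl] at h₃
    rw [hb, show Nat.fib 3 = 2 from rfl] at h₄
    have ha₀ : a ≠ 0 := by rintro rfl; simp at h₃
    have hb₀ : b ≠ 0 := by rintro rfl; simp at h₄
    rw [ha, hb] at hcop
    exact Nat.not_coprime_of_dvd_of_dvd (by norm_num) (dvd_pow_self 5 ha₀) (dvd_pow_self 5 hb₀) hcop
  subst hm
  refine ⟨rfl, ?_⟩
  rcases y with _ | y
  · rfl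
  · simp [pow_succ] at hprod
    lia

theorem eight_pow_ne_lucas_add_two_pow {r x : ℕ} (hx : 0 < x) : 8 ^ x ≠ lucas r + 2 ^ x := by
  intro h
  have hx₃ : x < 3 := by
    by_contra! hx₃
    refine not_eight_dvd_lucas r ((Nat.dvd_add_left (pow_dvd_pow 2 hx₃)).mp ?_)
    exact h ▸ dvd_pow_self 8 hx.ne'
  interval_cases x
  · have hr : r ≤ 6 := (le_lucas r).1.trans (by lia)
    interval_cases r <;> simp [lucas] at h
  · exact not_five_dvd_lucas r (by lia)

theorem fib_succ_dvd_of_fib_pow_sub_eq_lucas {n r x : ℕ}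
    (h : (Nat.fib (n + 3) : ℤ) ^ x - (Nat.fib n : ℤ) ^ x = lucas r) :
    Nat.fib (n + 1) ∣ lucas r := by
  zify
  have h₂ := Nat.fib_add_two (n := n)
  have h₃ := Nat.fib_add_two (n := n + 1)
  zify at h₂ h₃
  have hdiff : (Nat.fib (n + 3) : ℤ) - Nat.fib n = Nat.fib (n + 1) * 2 := by
    linear_combination h₃ + h₂
  exact h ▸ (Dvd.intro _ hdiff.symm).trans (sub_dvd_pow_sub_pow _ _ x)

theorem fib_add_three_pow_sub_fib_pow_eq_lucas (n r x : ℕ) (hx : 0 < x) :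
    (Nat.fib (n + 3) : ℤ) ^ x - (Nat.fib n : ℤ) ^ x = lucas r ↔
      (n, r, x) ∈ ({(0, 3, 2), (0, 0, 1), (1, 0, 1), (2, 3, 1)} : Set (ℕ × ℕ × ℕ)) := by
  simp only [Set.mem_insert_iff, Set.mem_singleton_iff, Prod.mk.injEq]
  constructor
  · intro h
    have hn : n ≤ 3 := by
      have := le_four_of_fib_dvd_lucas (fib_succ_dvd_of_fib_pow_sub_eq_lucas h)
      lia
    rw [sub_eq_iff_eq_add] at h
    norm_cast at h
    interval_cases n
    · have h₂ : 2 ^ x = lucas r := by simpa [Nat.fib_add_two, hx.ne'] using h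
      have := two_pow_eq_lucas hx h₂
      lia
    · have h₃ : 3 ^ x = lucas r + 1 := by simpa [Nat.fib_add_two] using h
      have := three_pow_eq_lucas_add_one h₃
      lia
    · have h₅ : 5 ^ x = lucas r + 1 := by simpa [Nat.fib_add_two] using h
      have := five_pow_eq_lucas_add_one hx h₅
      lia
    · exact absurd h (eight_pow_ne_lucas_add_two_pow hx)
  · rintro (⟨rfl, rfl, rfl⟩ | ⟨rfl, rfl, rfl⟩ | ⟨rfl, rfl, rfl⟩ | ⟨rfl, rfl, rfl⟩) <;>
      simp [lucas, Nat.fib_add_two]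
end

section
/- The Diophantine equation 5^x − 3^x = L_r in nonnegative integers r, x has only the solution (r, x) = (0, 1). -/
theorem lucas_add_fib : ∀ n, lucas n + Nat.fib n = 2 * Nat.fib (n + 1)
  | 0 => rfl
  | 1 => rfl
  | n + 2 => by
    have h₀ := lucas_add_fib n
    have h₁ : lucas (n + 1) + Nat.fib (n + 1) = 2 * Nat.fib (n + 2) := lucas_add_fib (n + 1)
    have f₂ : Nat.fib (n + 2) = Nat.fib n + Nat.fib (n + 1) := Nat.fib_add_two
    have f₃ : Nat.fib (n + 2 + 1) = Nat.fib (n + 1) + Nat.fib (n + 2) := Nat.fib_add_two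
    rw [lucas]
    omega

/-- A return of the Fibonacci sequence to its initial values modulo `m` gives a period. -/
theorem fib_mod_periodic {m p : ℕ} (h₀ : Nat.fib p ≡ 0 [MOD m])
    (h₁ : Nat.fib (p + 1) ≡ 1 [MOD m]) :
    Function.Periodic (fun n => Nat.fib n % m) p := by
  have key : ∀ n, Nat.fib (n + 1 + p) ≡ Nat.fib (n + 1) [MOD m] := fun n => by
    rw [show n + 1 + p = n + p + 1 by ring, Nat.fib_add]
    simpa using (h₀.mul_left (Nat.fib n)).add (h₁.mul_left (Nat.fib (n + 1)))
  rintro (_ | n)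
  · simpa [Nat.ModEq] using h₀
  · exact key n

/-- If `a * b ^ p ≡ a` modulo `m`, then `p` is a period of `n ↦ a * b ^ n` modulo `m`. -/
theorem mul_pow_mod_periodic {m a b p : ℕ} (h : a * b ^ p ≡ a [MOD m]) :
    Function.Periodic (fun n => a * b ^ n % m) p := fun n => by
  have := h.mul_right (b ^ n)
  rwa [mul_assoc, ← pow_add, add_comm p n] at this

/-- There is no solution with `2 ≤ x`, by a congruence obstruction modulo
`24552 = 8 * 9 * 11 * 31`. -/
theorem five_pow_ne_three_pow_add_lucas (r y : ℕ) :
    5 ^ (y + 2) ≠ 3 ^ (y + 2) + lucas r := by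
  intro h
  have h5 : 25 * 5 ^ (y % 30) ≡ 25 * 5 ^ y [MOD 24552] :=
    (mul_pow_mod_periodic (p := 30) (by decide)).map_mod_nat y
  have h3 : 9 * 3 ^ (y % 30) ≡ 9 * 3 ^ y [MOD 24552] :=
    (mul_pow_mod_periodic (p := 30) (by decide)).map_mod_nat y
  have hfib : Function.Periodic (fun n => Nat.fib n % 24552) 120 :=
    fib_mod_periodic (by decide +kernel) (by decide +kernel)
  have hf : Nat.fib (r % 120) ≡ Nat.fib r [MOD 24552] := hfib.map_mod_nat r
  have hf' : Nat.fib (r % 120 + 1) ≡ Nat.fib (r + 1) [MOD 24552] :=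
    (hfib.add_const 1).map_mod_nat r
  have heq : 25 * 5 ^ y + Nat.fib r = 9 * 3 ^ y + 2 * Nat.fib (r + 1) := by
    have := lucas_add_fib r
    rw [pow_add, pow_add] at h
    omega
  have hmod : 25 * 5 ^ (y % 30) + Nat.fib (r % 120) ≡
      9 * 3 ^ (y % 30) + 2 * Nat.fib (r % 120 + 1) [MOD 24552] :=
    (h5.add hf).trans (heq ▸ (h3.add (hf'.mul_left 2)).symm)
  have obstruction : ∀ i < 30, ∀ j < 120, ¬ 25 * 5 ^ i + Nat.fib j ≡
      9 * 3 ^ i + 2 * Nat.fib (j + 1) [MOD 24552] := by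
    decide +kernel
  exact obstruction _ (Nat.mod_lt _ (by norm_num)) _ (Nat.mod_lt _ (by norm_num)) hmod

theorem lucas_pos : ∀ n, 0 < lucas n
  | 0 => by decide
  | 1 => by decide
  | n + 2 => Nat.add_pos_left (lucas_pos (n + 1)) _

theorem five_pow_sub_three_pow_eq_lucas (r x : ℕ) :
    (5 : ℤ) ^ x - 3 ^ x = lucas r ↔ (r, x) = (0, 1) := by
  constructor
  · intro h
    match x with
    | 0 =>
      have := lucas_pos r
      simp at h
      omega
    | 1 =>
      have hr : lucas r = 2 := by
        norm_num at h
        exact_mod_cast h.symm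
      rw [lucas_eq_two_iff.mp hr]
    | y + 2 =>
      refine absurd ?_ (five_pow_ne_three_pow_add_lucas r y)
      zify
      linarith
  · rintro ⟨⟩
    norm_num [lucas]
end
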